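/- For every M > 0 and C' > 0 there exists C > 0 depending only on a, b, c, M, C' such that the following holds. For every ε ∈ (0,1) and every map Q : closed unit ball of ℝ³ → S₀ which is continuous on the closed ball, smooth on the open ball B₁, satisfies Q(x) = s_*( x⊗x − (1/3)I ) for all x in the unit sphere, sup_{B₁} |Q| ≤ M, and sup_{B₁} |∇Q| ≤ C'/ε, one has the lower bound ∫_{B₁} f(Q(x)) dx ≥ ε³ / C. -/

import Mathlib

noncomputable section

open Matrix MeasureTheory Metric Set

attribute [local instance] Matrix.normedAddCommGroup Matrix.normedSpace

abbrev E3 : Type := EuclideanSpace ℝ (Fin 3)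
abbrev M3 : Type := Matrix (Fin 3) (Fin 3) ℝ

/-- The space of symmetric traceless real 3×3 matrices. -/
def S0 : Set M3 := {Q | Q.IsSymm ∧ Q.trace = 0}

def sstar (a b c : ℝ) : ℝ := (b + Real.sqrt (b ^ 2 + 24 * a * c)) / (4 * c)

def kconst (a b c : ℝ) : ℝ :=
  sstar a b c ^ 2 / 27 * (9 * a + 2 * b * sstar a b c - 3 * c * sstar a b c ^ 2)

/-- Bulk potential. -/
def fbulk (a b c : ℝ) (Q : M3) : ℝ :=
  kconst a b c - a / 2 * (Q * Q).trace - b / 3 * (Q * Q * Q).trace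
    + c / 4 * ((Q * Q).trace) ^ 2

/-- Partial derivative `∂ₖ Q` (componentwise). -/
def pd (Q : E3 → M3) (k : Fin 3) (x : E3) : M3 :=
  Matrix.of fun i j => fderiv ℝ (fun y => Q y i j) x (EuclideanSpace.single k 1)

/-- Squared Frobenius norm of a matrix. -/
def frobSq (A : M3) : ℝ := ∑ i, ∑ j, (A i j) ^ 2

def frobNorm (A : M3) : ℝ := Real.sqrt (frobSq A)

/-- `|∇Q|²`. -/
def gradSq (Q : E3 → M3) (x : E3) : ℝ := ∑ k : Fin 3, frobSq (pd Q k x)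

/-- Energy density `e_ε(Q)`. -/
def eDen (a b c ε : ℝ) (Q : E3 → M3) (x : E3) : ℝ :=
  1 / 2 * gradSq Q x + 1 / ε ^ 2 * fbulk a b c (Q x)

/-- Energy `E_ε(Q, U)`. -/
def energy (a b c ε : ℝ) (Q : E3 → M3) (U : Set E3) : ℝ :=
  ∫ x in U, eDen a b c ε Q x

/-- Componentwise Laplacian. -/
def lapM (Q : E3 → M3) (x : E3) : M3 :=
  ∑ k : Fin 3, Matrix.of fun i j =>
    fderiv ℝ (fun y => pd Q k y i j) x (EuclideanSpace.single k 1)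

/-- `|Q|² = tr(Q²)`. -/
def normSqM (Q : M3) : ℝ := (Q * Q).trace

/-- The Euler–Lagrange equation at a point. -/
def ELeq (a b c ε : ℝ) (Q : E3 → M3) (x : E3) : Prop :=
  (-(ε ^ 2)) • lapM Q x - a • Q x - b • (Q x * Q x)
    + (b / 3 * normSqM (Q x)) • (1 : M3) + (c * normSqM (Q x)) • Q x = 0

/-- Local minimizer of the Landau–de Gennes energy on an open set `ω`. -/
def IsLDGMin (a b c ε : ℝ) (ω : Set E3) (Q : E3 → M3) : Prop :=
  ∀ (x : E3) (r : ℝ), 0 < r → closedBall x r ⊆ ω →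
    ∀ P : E3 → M3, ContDiffOn ℝ (⊤ : ℕ∞) P ω → (∀ y ∈ ω, P y ∈ S0) →
      (∃ K : Set E3, IsCompact K ∧ K ⊆ ball x r ∧ ∀ y ∉ K, P y = Q y) →
      energy a b c ε Q (ball x r) ≤ energy a b c ε P (ball x r)

/-- The vacuum manifold `N`. -/
def Nman (a b c : ℝ) : Set M3 :=
  {P | ∃ n : Fin 3 → ℝ, (∑ i, (n i) ^ 2) = 1 ∧
    P = sstar a b c • (Matrix.vecMulVec n n - (1 / 3 : ℝ) • (1 : M3))}

/-- Frobenius distance to the vacuum manifold. -/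
def distN (a b c : ℝ) (Q : M3) : ℝ :=
  sInf ((fun P => frobNorm (Q - P)) '' Nman a b c)

/-- Directional derivative `v·∇Q = Σₖ vₖ ∂ₖQ`. -/
def dirD (Q : E3 → M3) (v : E3) (x : E3) : M3 := ∑ k : Fin 3, v k • pd Q k x

/-- Admissible cutoff profile. -/
def AdmissibleCutoff (φ : ℝ → ℝ) : Prop :=
  ContDiff ℝ (⊤ : ℕ∞) φ ∧ (∀ t, 0 ≤ φ t) ∧ (∀ t, 10 ≤ t → φ t = 0) ∧
    (∀ t ∈ Icc (0 : ℝ) 8, 1 ≤ φ t) ∧ φ 0 = 60 ∧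
    (∀ t, 0 ≤ t → |deriv φ t| ≤ 100) ∧
    (∀ t ∈ Icc (0 : ℝ) 8, deriv φ t ∈ Icc (-2 : ℝ) (-1)) ∧
    (∀ t, 0 ≤ t → deriv φ t ≤ 0)

/-- The density `Θ_ρ^φ(Q, x)`. -/
def Theta (a b c ε : ℝ) (φ : ℝ → ℝ) (Q : E3 → M3) (x : E3) (ρ : ℝ) : ℝ :=
  ρ⁻¹ * ∫ y in ball x (Real.sqrt 10 * ρ), eDen a b c ε Q y * φ (‖y - x‖ ^ 2 / ρ ^ 2)

/-- The regular scale `r(Q, x)`. -/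
def regScale (a b c ε : ℝ) (Q : E3 → M3) (x : E3) : ℝ :=
  sSup {ρ : ℝ | 0 ≤ ρ ∧ ρ ≤ 1 ∧ ∀ y ∈ ball x ρ, ρ ^ 2 * eDen a b c ε Q y ≤ 1}

/-- The bad set `Bad(Q; s, δ)`. -/
def badSet (a b c ε : ℝ) (Q : E3 → M3) (s δ : ℝ) : Set E3 :=
  {y | regScale a b c ε Q y < s} ∪ {y | δ < distN a b c (Q y)}


def ent (A : E3 →L[ℝ] E3) (i j : Fin 3) : ℝ := (A (EuclideanSpace.single j 1)) i

lemma ent_cont (i j : Fin 3) : Continuous (fun A : E3 →L[ℝ] E3 => ent A i j) := by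
  unfold ent
  fun_prop

def cc1 (A : E3 →L[ℝ] E3) : ℝ := ent A 0 0 + ent A 1 1 + ent A 2 2
def cc2 (A : E3 →L[ℝ] E3) : ℝ :=
  ent A 0 0 * ent A 1 1 - ent A 0 1 * ent A 1 0 + (ent A 0 0 * ent A 2 2 - ent A 0 2 * ent A 2 0)
    + (ent A 1 1 * ent A 2 2 - ent A 1 2 * ent A 2 1)
def cc3 (A : E3 →L[ℝ] E3) : ℝ :=
  ent A 0 0 * ent A 1 1 * ent A 2 2 - ent A 0 0 * ent A 1 2 * ent A 2 1
    - ent A 0 1 * ent A 1 0 * ent A 2 2 + ent A 0 1 * ent A 1 2 * ent A 2 0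
    + ent A 0 2 * ent A 1 0 * ent A 2 1 - ent A 0 2 * ent A 1 1 * ent A 2 0

lemma cc1_cont : Continuous cc1 := by
  have := ent_cont
  unfold cc1; fun_prop
lemma cc2_cont : Continuous cc2 := by
  have := ent_cont
  unfold cc2; fun_prop
lemma cc3_cont : Continuous cc3 := by
  have := ent_cont
  unfold cc3; fun_prop

lemma det_expand (A : E3 →L[ℝ] E3) (t : ℝ) :
    (ContinuousLinearMap.id ℝ E3 + t • A).det = 1 + t * cc1 A + t ^ 2 * cc2 A + t ^ 3 * cc3 A := by
  rw [ContinuousLinearMap.det,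
    ← LinearMap.det_toMatrix (EuclideanSpace.basisFun (Fin 3) ℝ).toBasis, Matrix.det_fin_three]
  simp [LinearMap.toMatrix_apply, cc1, cc2, cc3, ent]
  ring

set_option maxHeartbeats 1000000 in
lemma no_retr (r : E3 → E3) (K : ℝ)
    (hL : ∀ x ∈ closedBall (0 : E3) 1, ∀ y ∈ closedBall (0 : E3) 1, ‖r x - r y‖ ≤ K * ‖x - y‖)
    (hd : ∀ x ∈ ball (0 : E3) 1, DifferentiableAt ℝ r x)
    (h1 : ∀ x ∈ closedBall (0 : E3) 1, ‖r x‖ = 1)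
    (hS : ∀ x ∈ sphere (0 : E3) 1, r x = x) : False := by
  classical
  set G : E3 → E3 := fun x => if ‖x‖ ≤ 1 then r x - x else 0 with hG
  set L : ℝ := 2 * (|K| + 1) with hLdef
  have hLpos : 0 < L := by positivity
  have hin : ∀ x y : E3, ‖x‖ ≤ 1 → ‖y‖ ≤ 1 → ‖(r x - x) - (r y - y)‖ ≤ (|K| + 1) * ‖x - y‖ := by
    intro x y hx hy
    have h := hL x (by simpa using hx) y (by simpa using hy)
    have e : (r x - x) - (r y - y) = (r x - r y) - (x - y) := by abel
    rw [e]
    have h2 := norm_sub_le (r x - r y) (x - y)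
    have h3 : K * ‖x - y‖ ≤ |K| * ‖x - y‖ := by gcongr; exact le_abs_self K
    linarith
  have hmix : ∀ x y : E3, ‖x‖ ≤ 1 → ¬ ‖y‖ ≤ 1 → ‖r x - x‖ ≤ L * ‖x - y‖ := by
    intro x y hx hy
    push Not at hy
    have hy0 : 0 < ‖y‖ := by linarith
    set z := ‖y‖⁻¹ • y with hz
    have hzn : ‖z‖ = 1 := by rw [hz, norm_smul, norm_inv, norm_norm]; field_simp
    have hzr : r z = z := hS z (by simpa using hzn)
    have h := hin x z hx hzn.le
    rw [hzr, sub_self, sub_zero] at h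
    have hyz : ‖y - z‖ = ‖y‖ - 1 := by
      have e : y - z = (1 - ‖y‖⁻¹) • y := by rw [hz, sub_smul, one_smul]
      have h0 : 0 ≤ 1 - ‖y‖⁻¹ := by
        have := inv_le_one_of_one_le₀ hy.le
        linarith
      rw [e, norm_smul, Real.norm_of_nonneg h0]; field_simp
    have h4 : ‖y‖ - ‖x‖ ≤ ‖x - y‖ := by
      rw [norm_sub_rev]; exact norm_sub_norm_le y x
    have h5 : ‖x - z‖ ≤ 2 * ‖x - y‖ := by
      have := norm_sub_le_norm_sub_add_norm_sub x y z
      linarith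
    have h6 : (|K| + 1) * ‖x - z‖ ≤ (|K| + 1) * (2 * ‖x - y‖) := by gcongr
    rw [hLdef]; linarith
  have hGL : ∀ x y, ‖G x - G y‖ ≤ L * ‖x - y‖ := by
    intro x y
    by_cases hx : ‖x‖ ≤ 1 <;> by_cases hy : ‖y‖ ≤ 1
    · simp only [hG, hx, hy, if_true]
      have := hin x y hx hy
      have h3 : 0 ≤ (|K| + 1) * ‖x - y‖ := by positivity
      rw [hLdef]; linarith
    · simp only [hG, hx, hy, if_true, if_false, sub_zero]
      exact hmix x y hx hy
    · simp only [hG, hx, hy, if_true, if_false, zero_sub, norm_neg]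
      rw [norm_sub_rev x y]
      exact hmix y x hy hx
    · simp only [hG, hx, hy, if_false, sub_zero, norm_zero]; positivity
  have hGLip : LipschitzWith ⟨L, hLpos.le⟩ G :=
    LipschitzWith.of_dist_le_mul (by intro x y; rw [dist_eq_norm, dist_eq_norm]; exact hGL x y)
  have hGeq : ∀ x ∈ ball (0 : E3) 1, G =ᶠ[nhds x] fun y => r y - y := by
    intro x hx
    filter_upwards [isOpen_ball.mem_nhds hx] with y hy
    have : ‖y‖ ≤ 1 := by simpa using (mem_ball_zero_iff.1 hy).le
    simp only [hG, this, if_true]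
  have hGd : ∀ x ∈ ball (0 : E3) 1, DifferentiableAt ℝ G x := by
    intro x hx
    exact ((hd x hx).sub differentiableAt_id).congr_of_eventuallyEq (hGeq x hx)
  set A : E3 → (E3 →L[ℝ] E3) := fun x => fderiv ℝ G x with hA
  have hAb : ∀ x, ‖A x‖ ≤ L := fun x => norm_fderiv_le_of_lipschitz ℝ hGLip
  have hAm : Measurable A := measurable_fderiv ℝ G
  have hbd : ∀ φ : (E3 →L[ℝ] E3) → ℝ, Continuous φ → ∃ B, 0 ≤ B ∧ ∀ x, |φ (A x)| ≤ B := by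
    intro φ hφ
    obtain ⟨B, hB⟩ := (isCompact_closedBall (0 : E3 →L[ℝ] E3) L).exists_bound_of_continuousOn
      hφ.continuousOn
    refine ⟨B, ?_, fun x => hB _ (by simpa using hAb x)⟩
    exact (norm_nonneg _).trans (hB 0 (by simpa using hLpos.le))
  have hint : ∀ φ : (E3 →L[ℝ] E3) → ℝ, Continuous φ →
      IntegrableOn (fun x => φ (A x)) (ball (0 : E3) 1) := by
    intro φ hφ
    obtain ⟨B, hB0, hB⟩ := hbd φ hφ
    refine Measure.integrableOn_of_bounded (M := B) measure_ball_lt_top.ne ?_ ?_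
    · exact (hφ.measurable.comp hAm).aestronglyMeasurable
    · exact Filter.Eventually.of_forall hB
  set V : ℝ := volume.real (ball (0 : E3) 1) with hV
  have hVpos : 0 < V := by
    rw [hV, Measure.real]
    exact ENNReal.toReal_pos (measure_ball_pos volume _ one_pos).ne' measure_ball_lt_top.ne
  set I1 := ∫ x in ball (0 : E3) 1, cc1 (A x) with hI1
  set I2 := ∫ x in ball (0 : E3) 1, cc2 (A x) with hI2
  set I3 := ∫ x in ball (0 : E3) 1, cc3 (A x) with hI3
  have hdetint : ∀ t : ℝ, ∫ x in ball (0 : E3) 1, (ContinuousLinearMap.id ℝ E3 + t • A x).det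
      = V + t * I1 + t ^ 2 * I2 + t ^ 3 * I3 := by
    intro t
    simp only [det_expand]
    have i0 : IntegrableOn (fun _ : E3 => (1 : ℝ)) (ball (0 : E3) 1) :=
      integrableOn_const measure_ball_lt_top.ne
    have i1 := (hint _ cc1_cont).const_mul t
    have i2 := (hint _ cc2_cont).const_mul (t ^ 2)
    have i3 := (hint _ cc3_cont).const_mul (t ^ 3)
    have e1 := integral_add i0 i1
    have e2 := integral_add (i0.add i1) i2
    have e3 := integral_add ((i0.add i1).add i2) i3
    simp only [Pi.add_apply, integral_const_mul] at e1 e2 e3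
    rw [e3, e2, e1]
    simp [hV, hI1, hI2, hI3]
  obtain ⟨B1, hB1, hb1⟩ := hbd _ cc1_cont
  obtain ⟨B2, hB2, hb2⟩ := hbd _ cc2_cont
  obtain ⟨B3, hB3, hb3⟩ := hbd _ cc3_cont
  set τ : ℝ := 1 / (2 + L + B1 + B2 + B3) with hτ
  have hden : 0 < 2 + L + B1 + B2 + B3 := by positivity
  have hτpos : 0 < τ := by positivity
  have hτmul : τ * (2 + L + B1 + B2 + B3) = 1 := by rw [hτ]; field_simp
  have key : ∀ t : ℝ, 0 < t → t ≤ τ → V + t * I1 + t ^ 2 * I2 + t ^ 3 * I3 = V := by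
    intro t ht htτ
    have htm : t * (2 + L + B1 + B2 + B3) ≤ 1 := by
      rw [← hτmul]; gcongr
    have ht1 : t < 1 := by nlinarith
    have htL : t * L < 1 := by nlinarith
    have hnn : ∀ x, 0 ≤ (ContinuousLinearMap.id ℝ E3 + t • A x).det := by
      intro x
      rw [det_expand]
      have e1 : -(t * B1) ≤ t * cc1 (A x) := by nlinarith [abs_le.1 (hb1 x)]
      have t2 : t ^ 2 ≤ t := by nlinarith
      have t3 : t ^ 3 ≤ t := by nlinarith
      have e2 : -(t * B2) ≤ t ^ 2 * cc2 (A x) := by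
        have := (abs_le.1 (hb2 x)).1
        nlinarith [mul_le_mul_of_nonneg_right t2 hB2, sq_nonneg t]
      have e3 : -(t * B3) ≤ t ^ 3 * cc3 (A x) := by
        have := (abs_le.1 (hb3 x)).1
        nlinarith [mul_le_mul_of_nonneg_right t3 hB3, pow_pos ht 3]
      nlinarith
    set F : E3 → E3 := fun x => x + t • G x with hF
    have hFd : ∀ x ∈ ball (0 : E3) 1,
        HasFDerivWithinAt F (ContinuousLinearMap.id ℝ E3 + t • A x) (ball (0 : E3) 1) x := by
      intro x hx
      exact ((hasFDerivAt_id x).add ((hGd x hx).hasFDerivAt.const_smul t)).hasFDerivWithinAt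
    have hFinj : InjOn F (ball (0 : E3) 1) := by
      intro x _ y _ hxy
      by_contra hne
      have hpos : 0 < ‖x - y‖ := norm_pos_iff.2 (sub_ne_zero.2 hne)
      have e : x - y = -(t • (G x - G y)) := by
        simp only [hF] at hxy
        rw [smul_sub]
        have := sub_eq_zero.2 hxy
        rw [← sub_eq_zero, ← this]; abel
      have h2 : ‖x - y‖ = t * ‖G x - G y‖ := by
        conv_lhs => rw [e]
        rw [norm_neg, norm_smul, Real.norm_of_nonneg ht.le]
      have h3 := hGL x y
      nlinarith
    have himg : F '' ball (0 : E3) 1 = ball (0 : E3) 1 := by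
      apply Subset.antisymm
      · rintro _ ⟨x, hx, rfl⟩
        have hx' : ‖x‖ < 1 := by simpa using hx
        have e : F x = (1 - t) • x + t • r x := by
          simp only [hF, hG, hx'.le, if_true]
          rw [smul_sub, sub_smul, one_smul]; abel
        have hr := h1 x (by simpa using hx'.le)
        rw [mem_ball_zero_iff, e]
        calc ‖(1 - t) • x + t • r x‖ ≤ ‖(1 - t) • x‖ + ‖t • r x‖ := norm_add_le _ _
          _ = (1 - t) * ‖x‖ + t := by
            rw [norm_smul, norm_smul, hr, Real.norm_of_nonneg ht.le,
              Real.norm_of_nonneg (by linarith : 0 ≤ 1 - t), mul_one]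
          _ < 1 := by nlinarith
      · intro y hy
        have hcon : ContractingWith ⟨t * L, by positivity⟩ (fun x => y - t • G x) := by
          refine ⟨Subtype.coe_lt_coe.1 htL, ?_⟩
          refine LipschitzWith.of_dist_le_mul ?_
          intro p q
          rw [dist_eq_norm, dist_eq_norm]
          have e : (y - t • G p) - (y - t • G q) = -(t • (G p - G q)) := by
            rw [smul_sub]; abel
          rw [e, norm_neg, norm_smul, Real.norm_of_nonneg ht.le]
          have := hGL p q
          show t * ‖G p - G q‖ ≤ t * L * ‖p - q‖
          rw [mul_assoc]; gcongr
        obtain ⟨x, hx⟩ : ∃ x, y - t • G x = x :=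
          ⟨_, hcon.fixedPoint_isFixedPt⟩
        have hFx : F x = y := by simp only [hF]; nth_rewrite 1 [← hx]; abel
        refine ⟨x, ?_, hFx⟩
        by_contra hxb
        have hx1 : 1 ≤ ‖x‖ := by simpa using hxb
        have hG0 : G x = 0 := by
          by_cases h : ‖x‖ ≤ 1
          · simp only [hG, h, if_true]
            rw [hS x (by simpa using le_antisymm h hx1), sub_self]
          · simp only [hG, h, if_false]
        rw [hG0, smul_zero, sub_zero] at hx
        rw [hx] at hy
        exact hxb hy
    have hcv := integral_image_eq_integral_abs_det_fderiv_smul volume measurableSet_ball hFd hFinj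
      (fun _ => (1 : ℝ))
    rw [himg] at hcv
    rw [← hdetint t]
    simp only [smul_eq_mul, mul_one, abs_of_nonneg (hnn _)] at hcv
    rw [← hcv]; simp [hV]
  have hdet1 : ∀ x ∈ ball (0 : E3) 1, (ContinuousLinearMap.id ℝ E3 + (1 : ℝ) • A x).det = 0 := by
    intro x hx
    have hr := (hd x hx).hasFDerivAt
    have hAe : ContinuousLinearMap.id ℝ E3 + (1 : ℝ) • A x = fderiv ℝ r x := by
      have : HasFDerivAt G (fderiv ℝ r x - ContinuousLinearMap.id ℝ E3) x :=
        (hr.sub (hasFDerivAt_id x)).congr_of_eventuallyEq (hGeq x hx)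
      have h2 : A x = fderiv ℝ r x - ContinuousLinearMap.id ℝ E3 := this.fderiv
      rw [h2, one_smul]; abel
    rw [hAe]
    by_contra hne
    have hconst : (fun y => inner ℝ (r y) (r y)) =ᶠ[nhds x] fun _ => (1 : ℝ) := by
      filter_upwards [isOpen_ball.mem_nhds hx] with y hy
      rw [real_inner_self_eq_norm_sq, h1 y (ball_subset_closedBall hy)]; norm_num
    have hz : ∀ v, inner ℝ (r x) (fderiv ℝ r x v) = 0 := by
      intro v
      have d1 := (hr.inner ℝ hr)
      have d2 : HasFDerivAt (fun y => inner ℝ (r y) (r y)) (0 : E3 →L[ℝ] ℝ) x :=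
        (hasFDerivAt_const (1 : ℝ) x).congr_of_eventuallyEq hconst
      have := congrArg (fun T : E3 →L[ℝ] ℝ => T v) (d1.unique d2)
      simp [fderivInnerCLM_apply] at this
      rw [real_inner_comm (r x)] at this
      linarith
    have hu : IsUnit (LinearMap.det (fderiv ℝ r x : E3 →ₗ[ℝ] E3)) := isUnit_iff_ne_zero.2 hne
    have hsurj : Function.Surjective (fderiv ℝ r x) :=
      (LinearMap.equivOfDetNeZero (fderiv ℝ r x : E3 →ₗ[ℝ] E3) hne).surjective
    obtain ⟨v, hv⟩ := hsurj (r x)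
    have := hz v
    rw [hv, real_inner_self_eq_norm_sq, h1 x (ball_subset_closedBall hx)] at this
    norm_num at this
  have hfin : V + 1 * I1 + 1 ^ 2 * I2 + 1 ^ 3 * I3 = 0 := by
    rw [← hdetint 1, setIntegral_congr_fun measurableSet_ball hdet1]; simp
  have k1 := key τ hτpos le_rfl
  have k2 := key (τ / 2) (by positivity) (by linarith)
  have k3 := key (τ / 4) (by positivity) (by linarith)
  have j1 : τ * I1 = 0 := by linarith
  have j2 : τ ^ 2 * I2 = 0 := by linarith
  have j3 : τ ^ 3 * I3 = 0 := by linarith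
  have z1 : I1 = 0 := by simpa [hτpos.ne'] using j1
  have z2 : I2 = 0 := by simpa [hτpos.ne'] using j2
  have z3 : I3 = 0 := by simpa [hτpos.ne'] using j3
  rw [z1, z2, z3] at hfin
  linarith

lemma sstar_spec (a b c : ℝ) (ha : 0 ≤ a) (hb : 0 < b) (hc : 0 < c) :
    b ≤ 2 * c * sstar a b c ∧ 3 * a = 2 * c * sstar a b c ^ 2 - b * sstar a b c := by
  have hnn : 0 ≤ b ^ 2 + 24 * a * c := by positivity
  have h1 := Real.sq_sqrt hnn
  have h2 : b ≤ Real.sqrt (b ^ 2 + 24 * a * c) := Real.le_sqrt_of_sq_le (by nlinarith [mul_nonneg ha hc.le])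
  set w := Real.sqrt (b ^ 2 + 24 * a * c) with hw
  have hs : 4 * c * sstar a b c = b + w := by unfold sstar; rw [← hw]; field_simp
  set s := sstar a b c
  refine ⟨by linarith, ?_⟩
  have hw' : w = 4 * c * s - b := by linarith
  rw [hw'] at h1
  have : c * (3 * a - (2 * c * s ^ 2 - b * s)) = 0 := by nlinarith
  rcases mul_eq_zero.1 this with h | h
  · exact absurd h hc.ne'
  · linarith

/-- The approximate projector. -/
def Tm (s : ℝ) (Q : M3) : M3 := s⁻¹ • Q + (1 / 3 : ℝ) • (1 : M3)

lemma frobSq_zero (A : M3) (h : frobSq A ≤ 0) : A = 0 := by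
  unfold frobSq at h
  ext i j
  have h1 : (A i j) ^ 2 ≤ ∑ j, (A i j) ^ 2 :=
    Finset.single_le_sum (f := fun j => (A i j) ^ 2) (fun _ _ => sq_nonneg _) (Finset.mem_univ j)
  have h2 : ∑ j, (A i j) ^ 2 ≤ ∑ i, ∑ j, (A i j) ^ 2 :=
    Finset.single_le_sum (f := fun i => ∑ j, (A i j) ^ 2)
      (fun _ _ => Finset.sum_nonneg fun _ _ => sq_nonneg _) (Finset.mem_univ i)
  have : A i j = 0 := by nlinarith [sq_nonneg (A i j)]
  simpa using this

lemma frobSq_nonneg (A : M3) : 0 ≤ frobSq A :=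
  Finset.sum_nonneg fun _ _ => Finset.sum_nonneg fun _ _ => sq_nonneg _

lemma S0_entries {Q : M3} (hQ : Q ∈ S0) : Q 1 0 = Q 0 1 ∧ Q 2 0 = Q 0 2 ∧ Q 2 1 = Q 1 2 ∧
    Q 2 2 = - Q 0 0 - Q 1 1 := by
  obtain ⟨h1, h2⟩ := hQ
  refine ⟨h1.apply 0 1, h1.apply 0 2, h1.apply 1 2, ?_⟩
  rw [Matrix.trace_fin_three] at h2
  linarith

lemma W_identity (Q : M3) (hQ : Q ∈ S0) (σ : ℝ) :
    frobSq (Q * Q - (σ / 3) • Q - (2 * σ ^ 2 / 9) • (1 : M3)) =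
      (Q * Q).trace ^ 2 / 2 - 2 * σ / 3 * (Q * Q * Q).trace - σ ^ 2 / 3 * (Q * Q).trace
        + 4 * σ ^ 4 / 27 := by
  obtain ⟨h10, h20, h21, h22⟩ := S0_entries hQ
  simp only [frobSq, Matrix.trace_fin_three, Matrix.mul_apply, Fin.sum_univ_three,
    Matrix.sub_apply, Matrix.smul_apply, smul_eq_mul, h10, h20, h21, h22]
  simp
  ring

lemma tr_sq (Q : M3) (hQ : Q ∈ S0) : (Q * Q).trace = frobSq Q := by
  obtain ⟨h10, h20, h21, h22⟩ := S0_entries hQ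
  simp only [frobSq, Matrix.trace_fin_three, Matrix.mul_apply, Fin.sum_univ_three,
    h10, h20, h21, h22]
  ring

lemma f_main (a b c : ℝ) (ha : 0 ≤ a) (hb : 0 < b) (hc : 0 < c) (Q : M3) (hQ : Q ∈ S0) :
    0 ≤ fbulk a b c Q ∧
      (fbulk a b c Q ≤ 0 → Tm (sstar a b c) Q * Tm (sstar a b c) Q = Tm (sstar a b c) Q) := by
  obtain ⟨hs1, hs2⟩ := sstar_spec a b c ha hb hc
  have hk : kconst a b c = sstar a b c ^ 2 / 27 * (9 * a + 2 * b * sstar a b c - 3 * c * sstar a b c ^ 2) := rfl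
  set s := sstar a b c with hs
  have hspos : 0 < s := by
    by_contra h
    push Not at h
    nlinarith
  have htr := tr_sq Q hQ
  have hq0 := frobSq_nonneg Q
  set σ := Real.sqrt (3 / 2 * frobSq Q) with hσ
  have hσ0 : 0 ≤ σ := Real.sqrt_nonneg _
  have hσ2 : σ ^ 2 = 3 / 2 * frobSq Q := Real.sq_sqrt (by positivity)
  have hq : (Q * Q).trace = 2 / 3 * σ ^ 2 := by rw [htr, hσ2]; ring
  have hW := W_identity Q hQ σ
  have hWn := frobSq_nonneg (Q * Q - (σ / 3) • Q - (2 * σ ^ 2 / 9) • (1 : M3))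
  set β := 2 * c * s / 9 - 2 * b / 27 with hβ
  have hβpos : 0 < β := by rw [hβ]; linarith
  have ha' : a = (2 * c * s ^ 2 - b * s) / 3 := by linarith
  have hf : σ * fbulk a b c Q = b / 2 * frobSq (Q * Q - (σ / 3) • Q - (2 * σ ^ 2 / 9) • (1 : M3))
      + σ * ((σ - s) ^ 2 * (c / 9 * σ ^ 2 + β * σ + β * s / 2)) := by
    unfold fbulk
    rw [hW, hk, hq, hβ, ha']
    ring
  have hg : 0 < c / 9 * σ ^ 2 + β * σ + β * s / 2 := by positivity
  have hcube : σ = 0 → fbulk a b c Q = s ^ 2 * (β * s / 2) := by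
    intro h0
    have hQ0 : Q = 0 := frobSq_zero Q (by rw [h0] at hσ2; linarith)
    unfold fbulk
    rw [hQ0, hk, ha', hβ]; simp; ring
  rcases hσ0.eq_or_lt with h0 | hpos
  · rw [hcube h0.symm]
    have : 0 < s ^ 2 * (β * s / 2) := by positivity
    exact ⟨this.le, fun h => absurd h (not_le.2 this)⟩
  · have hA : 0 ≤ (σ - s) ^ 2 * (c / 9 * σ ^ 2 + β * σ + β * s / 2) := by positivity
    have hnn : 0 ≤ fbulk a b c Q := by
      have : 0 ≤ σ * fbulk a b c Q := by rw [hf]; positivity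
      exact nonneg_of_mul_nonneg_right this hpos
    refine ⟨hnn, fun hle => ?_⟩
    have h0 : fbulk a b c Q = 0 := le_antisymm hle hnn
    rw [h0, mul_zero] at hf
    have t1 : 0 ≤ b / 2 * frobSq (Q * Q - (σ / 3) • Q - (2 * σ ^ 2 / 9) • (1 : M3)) := by positivity
    have t2 := mul_nonneg hpos.le hA
    have t3 : σ * ((σ - s) ^ 2 * (c / 9 * σ ^ 2 + β * σ + β * s / 2)) = 0 := by linarith
    have t4 : (σ - s) ^ 2 = 0 := by simpa [hpos.ne', hg.ne'] using t3
    have t5 : σ = s := by nlinarith [pow_eq_zero_iff (two_ne_zero) |>.1 t4]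
    have t6 : b / 2 * frobSq (Q * Q - (σ / 3) • Q - (2 * σ ^ 2 / 9) • (1 : M3)) = 0 := by linarith
    have t7 : frobSq (Q * Q - (σ / 3) • Q - (2 * σ ^ 2 / 9) • (1 : M3)) ≤ 0 := by
      by_contra h
      push Not at h
      have : 0 < b / 2 * frobSq (Q * Q - (σ / 3) • Q - (2 * σ ^ 2 / 9) • (1 : M3)) := by positivity
      linarith
    have t8 := frobSq_zero _ t7
    rw [t5] at t8
    have t9 : Q * Q = (s / 3) • Q + (2 * s ^ 2 / 9) • (1 : M3) := by
      rw [sub_sub, sub_eq_zero] at t8; exact t8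
    unfold Tm
    simp only [mul_add, add_mul, Matrix.smul_mul, Matrix.mul_smul, t9, mul_one, one_mul]
    ext i j
    simp only [Matrix.add_apply, Matrix.smul_apply, smul_eq_mul]
    field_simp
    ring

lemma normalize_lip (m : ℝ) (hm : 0 < m) (u v : E3) (hu : m ≤ ‖u‖) (hv : m ≤ ‖v‖) :
    ‖‖u‖⁻¹ • u - ‖v‖⁻¹ • v‖ ≤ 2 / m * ‖u - v‖ := by
  have hu0 : 0 < ‖u‖ := by linarith
  have hv0 : 0 < ‖v‖ := by linarith
  have e : ‖u‖⁻¹ • u - ‖v‖⁻¹ • v = ‖u‖⁻¹ • (u - v) + (‖u‖⁻¹ - ‖v‖⁻¹) • v := by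
    rw [smul_sub, sub_smul]; abel
  have h1 : ‖‖u‖⁻¹ • (u - v)‖ = ‖u‖⁻¹ * ‖u - v‖ := by
    rw [norm_smul, norm_inv, norm_norm]
  have h2 : ‖(‖u‖⁻¹ - ‖v‖⁻¹) • v‖ ≤ ‖u‖⁻¹ * ‖u - v‖ := by
    rw [norm_smul, Real.norm_eq_abs]
    have : ‖u‖⁻¹ - ‖v‖⁻¹ = ‖u‖⁻¹ * ((‖v‖ - ‖u‖) * ‖v‖⁻¹) := by field_simp
    rw [this, abs_mul, abs_mul, abs_of_pos (inv_pos.2 hu0), abs_of_pos (inv_pos.2 hv0)]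
    have h3 := abs_norm_sub_norm_le v u
    rw [norm_sub_rev] at h3
    rw [mul_assoc, mul_assoc, inv_mul_cancel₀ hv0.ne', mul_one]
    gcongr
  have h4 : ‖u‖⁻¹ ≤ m⁻¹ := inv_anti₀ hm hu
  rw [e]
  calc _ ≤ _ := norm_add_le _ _
    _ ≤ ‖u‖⁻¹ * ‖u - v‖ + ‖u‖⁻¹ * ‖u - v‖ := by rw [h1]; gcongr
    _ ≤ m⁻¹ * ‖u - v‖ + m⁻¹ * ‖u - v‖ := by gcongr
    _ = _ := by ring

def uit (T : E3 → (E3 →L[ℝ] E3)) (N : ℕ) (e : E3) : ℕ → E3 → E3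
  | 0, _ => e
  | k + 1, x => T ((((k + 1 : ℕ) : ℝ) / N) • x) (uit T N e k x)

set_option maxHeartbeats 1000000 in
lemma topo (T : E3 → (E3 →L[ℝ] E3)) (K : ℝ)
    (hL : ∀ x ∈ closedBall (0 : E3) 1, ∀ y ∈ closedBall (0 : E3) 1, ‖T x - T y‖ ≤ K * ‖x - y‖)
    (hd : ∀ x ∈ ball (0 : E3) 1, DifferentiableAt ℝ T x)
    (hgood : ∀ x ∈ closedBall (0 : E3) 1, ‖T x * T x - T x‖ ≤ 1 / 8)
    (hS : ∀ x ∈ sphere (0 : E3) 1, ∀ v, T x v = (inner ℝ x v : ℝ) • x)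
    (e : E3) (he0 : e ≠ 0) (he : ‖T 0 e - e‖ ≤ 1 / 2 * ‖e‖) : False := by
  obtain ⟨N, hN⟩ := exists_nat_gt (4 * |K| + 1)
  have hNpos : (0 : ℝ) < N := by have := abs_nonneg K; linarith
  have hKN : |K| / N ≤ 1 / 4 := by rw [div_le_iff₀ hNpos]; linarith
  have hfrac : ∀ k : ℕ, k ≤ N → (k : ℝ) / N ≤ 1 := by
    intro k hk
    rw [div_le_one hNpos]; exact_mod_cast hk
  have hsc : ∀ k : ℕ, k ≤ N → ∀ x : E3, ‖((k : ℝ) / N) • x‖ ≤ ‖x‖ := by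
    intro k hk x
    rw [norm_smul, Real.norm_of_nonneg (by positivity)]
    exact mul_le_of_le_one_left (norm_nonneg x) (hfrac k hk)
  have hscc : ∀ k : ℕ, k ≤ N → ∀ x ∈ closedBall (0 : E3) 1,
      ((k : ℝ) / N) • x ∈ closedBall (0 : E3) 1 := by
    intro k hk x hx
    rw [mem_closedBall_zero_iff] at *
    exact (hsc k hk x).trans hx
  have hL' : ∀ x ∈ closedBall (0 : E3) 1, ∀ y ∈ closedBall (0 : E3) 1,
      ‖T x - T y‖ ≤ |K| * ‖x - y‖ := fun x hx y hy =>
    (hL x hx y hy).trans (by gcongr; exact le_abs_self K)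
  -- invariant
  have hinv : ∀ k : ℕ, k ≤ N → ∀ x ∈ closedBall (0 : E3) 1, uit T N e k x ≠ 0 ∧
      ‖T (((k : ℝ) / N) • x) (uit T N e k x) - uit T N e k x‖ ≤ 1 / 2 * ‖uit T N e k x‖ := by
    intro k
    induction k with
    | zero => intro _ x _; simpa [uit] using And.intro he0 he
    | succ k ih =>
      intro hk x hx
      obtain ⟨i0, i1⟩ := ih (by omega) x hx
      set u := uit T N e k x with hu
      set p := ((k : ℝ) / N) • x with hp
      set q := (((k + 1 : ℕ) : ℝ) / N) • x with hq
      have hpB := hscc k (by omega) x hx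
      have hqB := hscc (k + 1) hk x hx
      have hx1 : ‖x‖ ≤ 1 := by simpa using hx
      have hpq : ‖q - p‖ ≤ 1 / N := by
        have : q - p = (1 / (N : ℝ)) • x := by
          rw [hq, hp, ← sub_smul]; congr 1; push_cast; ring
        rw [this, norm_smul, Real.norm_of_nonneg (by positivity)]
        exact mul_le_of_le_one_right (by positivity) hx1
      have hT : ‖T q - T p‖ ≤ 1 / 4 := by
        refine (hL' q hqB p hpB).trans ?_
        calc |K| * ‖q - p‖ ≤ |K| * (1 / N) := by gcongr
          _ ≤ 1 / 4 := by rw [mul_one_div]; exact hKN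
      have hupos : 0 < ‖u‖ := norm_pos_iff.2 i0
      have hv : uit T N e (k + 1) x = T q u := rfl
      rw [hv]
      have h1 : ‖T q u - T p u‖ ≤ 1 / 4 * ‖u‖ := by
        have := (T q - T p).le_opNorm u
        rw [_root_.sub_apply] at this
        exact this.trans (by gcongr)
      have h2 : 1 / 4 * ‖u‖ ≤ ‖T q u‖ := by
        have e1 : u = T q u - (T q u - T p u) - (T p u - u) := by abel
        have n1 : ‖u‖ ≤ ‖T q u‖ + ‖T q u - T p u‖ + ‖T p u - u‖ := by
          conv_lhs => rw [e1]
          exact (norm_sub_le _ _).trans (by gcongr; exact norm_sub_le _ _)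
        linarith
      have h3 : ‖T q (T q u) - T q u‖ ≤ 1 / 8 * ‖u‖ := by
        have := (T q * T q - T q).le_opNorm u
        rw [_root_.sub_apply, mul_apply_eq_comp] at this
        exact this.trans (by gcongr; exact hgood q hqB)
      refine ⟨?_, by linarith⟩
      intro h0
      rw [h0, norm_zero] at h2
      linarith
  have hTb : ∃ B, 0 ≤ B ∧ ∀ x ∈ closedBall (0 : E3) 1, ‖T x‖ ≤ B := by
    refine ⟨‖T 0‖ + |K|, by positivity, fun x hx => ?_⟩
    have h0 := hL' x hx 0 (by simp)
    have hx1 : ‖x‖ ≤ 1 := by simpa using hx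
    rw [sub_zero] at h0
    have h2 : |K| * ‖x‖ ≤ |K| := mul_le_of_le_one_right (abs_nonneg _) hx1
    have h3 : ‖T x‖ ≤ ‖T 0‖ + ‖T x - T 0‖ := by
      have := norm_add_le (T 0) (T x - T 0)
      rwa [add_sub_cancel] at this
    linarith
  obtain ⟨B, hB0, hB⟩ := hTb
  have hlip : ∀ k : ℕ, k ≤ N → ∃ D R : ℝ, 0 ≤ D ∧ 0 ≤ R ∧
      (∀ x ∈ closedBall (0 : E3) 1, ‖uit T N e k x‖ ≤ R) ∧
      (∀ x ∈ closedBall (0 : E3) 1, ∀ y ∈ closedBall (0 : E3) 1,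
        ‖uit T N e k x - uit T N e k y‖ ≤ D * ‖x - y‖) := by
    intro k
    induction k with
    | zero =>
      intro _
      exact ⟨0, ‖e‖, le_rfl, norm_nonneg _, fun x _ => le_rfl, fun x _ y _ => by simp [uit]⟩
    | succ k ih =>
      intro hk
      obtain ⟨D, R, hD, hR, hr, hl⟩ := ih (by omega)
      refine ⟨B * D + |K| * R, B * R, by positivity, by positivity, ?_, ?_⟩
      · intro x hx
        show ‖T _ (uit T N e k x)‖ ≤ _
        refine (ContinuousLinearMap.le_opNorm _ _).trans ?_
        have := hB _ (hscc (k + 1) hk x hx)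
        have := hr x hx
        gcongr
      · intro x hx y hy
        set p := (((k + 1 : ℕ) : ℝ) / N) • x with hp
        set q := (((k + 1 : ℕ) : ℝ) / N) • y with hq
        have hpB := hscc (k + 1) hk x hx
        have hqB := hscc (k + 1) hk y hy
        show ‖T p (uit T N e k x) - T q (uit T N e k y)‖ ≤ _
        have e1 : T p (uit T N e k x) - T q (uit T N e k y) =
            T p (uit T N e k x - uit T N e k y) + (T p - T q) (uit T N e k y) := by
          rw [map_sub, _root_.sub_apply]; abel
        have hpq : ‖p - q‖ ≤ ‖x - y‖ := by
          rw [hp, hq, ← smul_sub]; exact hsc (k + 1) hk _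
        have h1 : ‖T p (uit T N e k x - uit T N e k y)‖ ≤ B * (D * ‖x - y‖) := by
          refine (ContinuousLinearMap.le_opNorm _ _).trans ?_
          have := hB _ hpB
          have := hl x hx y hy
          gcongr
        have h2 : ‖(T p - T q) (uit T N e k y)‖ ≤ (|K| * ‖x - y‖) * R := by
          refine (ContinuousLinearMap.le_opNorm _ _).trans ?_
          have := hL' p hpB q hqB
          have := hr y hy
          have h5 : |K| * ‖p - q‖ ≤ |K| * ‖x - y‖ := by gcongr
          gcongr
          linarith
        rw [e1]
        refine (norm_add_le _ _).trans ?_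
        linarith
  have hdiff : ∀ k : ℕ, k ≤ N → ∀ x ∈ ball (0 : E3) 1, DifferentiableAt ℝ (uit T N e k) x := by
    intro k
    induction k with
    | zero => intro _ x _; exact differentiableAt_const e
    | succ k ih =>
      intro hk x hx
      have hxB : (((k + 1 : ℕ) : ℝ) / N) • x ∈ ball (0 : E3) 1 := by
        rw [mem_ball_zero_iff] at *
        exact (hsc (k + 1) hk x).trans_lt hx
      have h1 : DifferentiableAt ℝ (fun x : E3 => T ((((k + 1 : ℕ) : ℝ) / N) • x)) x :=
        DifferentiableAt.comp (g := T) (f := fun x : E3 => (((k + 1 : ℕ) : ℝ) / N) • x) x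
          (hd _ hxB) (by fun_prop)
      exact h1.clm_apply (ih (by omega) x hx)
  set u := uit T N e N with hu
  obtain ⟨D, R, hD, hR, hr, hl⟩ := hlip N le_rfl
  rw [← hu] at hr hl
  have hne : ∀ x ∈ closedBall (0 : E3) 1, u x ≠ 0 := fun x hx => (hinv N le_rfl x hx).1
  have hcont : ContinuousOn u (closedBall (0 : E3) 1) := by
    have : LipschitzOnWith ⟨D, hD⟩ u (closedBall (0 : E3) 1) :=
      LipschitzOnWith.of_dist_le_mul (by
        intro x hx y hy; rw [dist_eq_norm, dist_eq_norm]; exact hl x hx y hy)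
    exact this.continuousOn
  obtain ⟨m, hm, hmu⟩ : ∃ m, 0 < m ∧ ∀ x ∈ closedBall (0 : E3) 1, m ≤ ‖u x‖ := by
    obtain ⟨x0, hx0, hmin⟩ := (isCompact_closedBall (0 : E3) 1).exists_isMinOn
      ⟨0, by simp⟩ hcont.norm
    exact ⟨‖u x0‖, norm_pos_iff.2 (hne x0 hx0), fun x hx => hmin hx⟩
  have hsph : ∀ x ∈ sphere (0 : E3) 1, u x = (inner ℝ x (u x) : ℝ) • x := by
    intro x hx
    obtain ⟨k, hk⟩ : ∃ k, N = k + 1 := Nat.exists_eq_succ_of_ne_zero (by rintro rfl; simp at hNpos)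
    have h1 : u x = T x (uit T N e k x) := by
      have : u x = uit T N e (k + 1) x := by rw [hu, ← hk]
      rw [this]
      show T _ _ = _
      rw [← hk, div_self hNpos.ne', one_smul]
    have hx1 : ‖x‖ = 1 := by simpa using hx
    rw [h1, hS x hx, inner_smul_right, real_inner_self_eq_norm_sq, hx1]
    simp
  have hss : sphere (0 : E3) 1 ⊆ closedBall 0 1 := sphere_subset_closedBall
  have hφne : ∀ x ∈ sphere (0 : E3) 1, (inner ℝ x (u x) : ℝ) ≠ 0 := by
    intro x hx h0
    have := hsph x hx
    rw [h0, zero_smul] at this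
    exact hne x (hss hx) this
  have hφc : ContinuousOn (fun x => (inner ℝ x (u x) : ℝ)) (sphere (0 : E3) 1) :=
    continuousOn_id.inner (hcont.mono hss)
  have hconn : IsPreconnected (sphere (0 : E3) 1) := by
    apply isPreconnected_sphere
    rw [← Module.finrank_eq_rank]
    simp
  obtain ⟨η, hη, hsign⟩ : ∃ η : ℝ, (η = 1 ∨ η = -1) ∧
      ∀ x ∈ sphere (0 : E3) 1, 0 < η * (inner ℝ x (u x) : ℝ) := by
    by_cases hex : ∃ x ∈ sphere (0 : E3) 1, (inner ℝ x (u x) : ℝ) < 0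
    · obtain ⟨x, hx, hneg⟩ := hex
      refine ⟨-1, Or.inr rfl, fun y hy => ?_⟩
      by_contra hcon
      have hy0 : (0 : ℝ) ≤ inner ℝ y (u y) := by linarith
      obtain ⟨z, hz, hz0⟩ := hconn.intermediate_value hx hy hφc ⟨hneg.le, hy0⟩
      exact hφne z hz hz0
    · push Not at hex
      refine ⟨1, Or.inl rfl, fun y hy => ?_⟩
      have := hex y hy
      have := hφne y hy
      rw [one_mul]
      exact lt_of_le_of_ne (hex y hy) this.symm
  have hηη : η * η = 1 := by rcases hη with h | h <;> rw [h] <;> norm_num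
  have hηn : ‖η‖ = 1 := by rcases hη with h | h <;> rw [h] <;> norm_num
  refine no_retr (fun x => η • (‖u x‖⁻¹ • u x)) (2 / m * D) ?_ ?_ ?_ ?_
  · intro x hx y hy
    rw [← smul_sub, norm_smul, hηn, one_mul]
    refine (normalize_lip m hm _ _ (hmu x hx) (hmu y hy)).trans ?_
    rw [mul_assoc]
    have := hl x hx y hy
    gcongr
  · intro x hx
    have hdu := hdiff N le_rfl x hx
    have hn := hne x (ball_subset_closedBall hx)
    exact (((hdu.norm ℝ hn).inv (norm_ne_zero_iff.2 hn)).smul hdu).const_smul η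
  · intro x hx
    rw [norm_smul, hηn, norm_smul, norm_inv, norm_norm, one_mul,
      inv_mul_cancel₀ (norm_ne_zero_iff.2 (hne x hx))]
  · intro x hx
    have hx1 : ‖x‖ = 1 := by simpa using hx
    have hpos := hsign x hx
    have h1 := hsph x hx
    set φ : ℝ := inner ℝ x (u x) with hφ
    have h2 : ‖u x‖ = η * φ := by
      rw [h1, norm_smul, hx1, mul_one, Real.norm_eq_abs, ← abs_of_pos hpos, abs_mul]
      rw [← Real.norm_eq_abs η, hηn, one_mul]
    show η • (‖u x‖⁻¹ • u x) = x
    rw [h2, h1, smul_smul, smul_smul]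
    have : η * (η * φ)⁻¹ * φ = 1 := by
      have hη0 : η ≠ 0 := by intro h; rw [h] at hηη; norm_num at hηη
      have hφ0 : φ ≠ 0 := hφne x hx
      rw [mul_inv]
      field_simp
    rw [this, one_smul]

/-- Matrices as operators, as a continuous linear map. -/
def Phi : M3 →L[ℝ] (E3 →L[ℝ] E3) :=
  LinearMap.toContinuousLinearMap
    ((Matrix.toEuclideanCLM (n := Fin 3) (𝕜 := ℝ)).toAlgEquiv.toLinearMap)

lemma Phi_apply (A : M3) : Phi A = Matrix.toEuclideanCLM (n := Fin 3) (𝕜 := ℝ) A := rfl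

lemma Phi_mul (A B : M3) : Phi (A * B) = Phi A * Phi B := by
  simp only [Phi_apply, map_mul]

lemma Phi_entry (A : M3) (v : E3) (i : Fin 3) : Phi A v i = ∑ j, A i j * v j := by
  rw [Phi_apply, Matrix.ofLp_toEuclideanCLM]; rfl

lemma fbulk_cont (a b c : ℝ) : Continuous (fbulk a b c) := by
  unfold fbulk
  fun_prop

lemma frobNorm_cont : Continuous frobNorm := by
  unfold frobNorm frobSq
  fun_prop

lemma entry_le_frob (A : M3) (i j : Fin 3) : |A i j| ≤ frobNorm A := by
  unfold frobNorm frobSq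
  apply Real.abs_le_sqrt
  have h1 : (A i j) ^ 2 ≤ ∑ j, (A i j) ^ 2 :=
    Finset.single_le_sum (f := fun j => (A i j) ^ 2) (fun _ _ => sq_nonneg _) (Finset.mem_univ j)
  have h2 : ∑ j, (A i j) ^ 2 ≤ ∑ i, ∑ j, (A i j) ^ 2 :=
    Finset.single_le_sum (f := fun i => ∑ j, (A i j) ^ 2)
      (fun _ _ => Finset.sum_nonneg fun _ _ => sq_nonneg _) (Finset.mem_univ i)
  exact h1.trans h2

lemma norm_le_frob (A : M3) : ‖A‖ ≤ frobNorm A :=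
  (Matrix.norm_le_iff (Real.sqrt_nonneg _)).2 fun i j => entry_le_frob A i j

lemma frob_compact (M : ℝ) : IsCompact {Q : M3 | frobNorm Q ≤ M} := by
  apply Metric.isCompact_of_isClosed_isBounded
  · exact isClosed_le frobNorm_cont continuous_const
  · refine (Metric.isBounded_closedBall (x := (0 : M3)) (r := M)).subset ?_
    intro Q hQ
    rw [mem_closedBall_zero_iff]
    exact (norm_le_frob Q).trans hQ

lemma S0_closed : IsClosed S0 := by
  have h1 : IsClosed {Q : M3 | Qᵀ = Q} := isClosed_eq (by fun_prop) continuous_id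
  have h2 : IsClosed {Q : M3 | Q.trace = 0} := isClosed_eq (by fun_prop) continuous_const
  exact h1.inter h2

/-- Defect of being a projector. -/
def defect (s : ℝ) (Q : M3) : ℝ := ‖Phi (Tm s Q * Tm s Q - Tm s Q)‖

lemma Tm_cont (s : ℝ) : Continuous (Tm s) := by
  unfold Tm
  fun_prop

lemma defect_cont (s : ℝ) : Continuous (defect s) := by
  unfold defect
  have := Tm_cont s
  exact (Phi.continuous.comp ((this.matrix_mul this).sub this)).norm

lemma fbulk_lower (a b c : ℝ) (ha : 0 ≤ a) (hb : 0 < b) (hc : 0 < c) (M : ℝ) :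
    ∃ δ > 0, ∀ Q ∈ S0, frobNorm Q ≤ M → 1 / 8 ≤ defect (sstar a b c) Q → δ ≤ fbulk a b c Q := by
  set S : Set M3 := {Q | frobNorm Q ≤ M} ∩ (S0 ∩ {Q | 1 / 8 ≤ defect (sstar a b c) Q}) with hSdef
  have hS : IsCompact S := (frob_compact M).inter_right
    (S0_closed.inter (isClosed_le continuous_const (defect_cont _)))
  rcases S.eq_empty_or_nonempty with hE | hE
  · refine ⟨1, one_pos, fun Q h1 h2 h3 => ?_⟩
    have : Q ∈ S := ⟨h2, h1, h3⟩
    rw [hE] at this; exact absurd this (notMem_empty Q)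
  · obtain ⟨P, hP, hmin⟩ := hS.exists_isMinOn hE (fbulk_cont a b c).continuousOn
    refine ⟨fbulk a b c P, ?_, fun Q h1 h2 h3 => hmin ⟨h2, h1, h3⟩⟩
    by_contra hle
    push Not at hle
    have h := (f_main a b c ha hb hc P hP.2.1).2 hle
    have h8 : 1 / 8 ≤ defect (sstar a b c) P := hP.2.2
    unfold defect at h8
    rw [h, sub_self, map_zero, norm_zero] at h8
    norm_num at h8

lemma entry_diff {Q : E3 → M3} {x : E3} (h : DifferentiableAt ℝ Q x) (i j : Fin 3) :
    DifferentiableAt ℝ (fun y => Q y i j) x := by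
  have := (LinearMap.toContinuousLinearMap (Matrix.entryLinearMap ℝ ℝ i j : M3 →ₗ[ℝ] ℝ)).differentiableAt.comp x h
  exact this

lemma Q_lip (Q : E3 → M3) (D : ℝ) (hD : 0 ≤ D)
    (hd : ∀ x ∈ ball (0 : E3) 1, DifferentiableAt ℝ Q x)
    (hg : ∀ x ∈ ball (0 : E3) 1, Real.sqrt (gradSq Q x) ≤ D) :
    ∀ x ∈ ball (0 : E3) 1, ∀ y ∈ ball (0 : E3) 1, ‖Q x - Q y‖ ≤ 3 * D * ‖x - y‖ := by
  intro x hx y hy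
  rw [Matrix.norm_le_iff (by positivity)]
  intro i j
  refine Convex.norm_image_sub_le_of_norm_fderiv_le (𝕜 := ℝ) (f := fun z => Q z i j)
    (s := ball (0 : E3) 1) (fun z hz => entry_diff (hd z hz) i j) ?_ (convex_ball _ _) hy hx
  intro z hz
  have hk : ∀ k : Fin 3, |fderiv ℝ (fun y => Q y i j) z (EuclideanSpace.single k 1)| ≤ D := by
    intro k
    refine le_trans ?_ (hg z hz)
    have h1 := entry_le_frob (pd Q k z) i j
    refine le_trans h1 (Real.sqrt_le_sqrt ?_)
    exact Finset.single_le_sum (f := fun k => frobSq (pd Q k z))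
      (fun k _ => frobSq_nonneg _) (Finset.mem_univ k)
  refine ContinuousLinearMap.opNorm_le_bound _ (by positivity) ?_
  intro v
  have hv : v = ∑ k, v k • EuclideanSpace.single k (1 : ℝ) := by
    ext l; simp [Finset.sum_apply, Pi.single_apply]
  have hvk : ∀ k, |v k| ≤ ‖v‖ := fun k => by
    simpa using PiLp.norm_apply_le v k
  set f' := fderiv ℝ (fun y => Q y i j) z
  have e : f' v = ∑ k, v k * f' (EuclideanSpace.single k 1) := by
    conv_lhs => rw [hv]
    simp [map_sum, map_smul]
  rw [e]
  calc ‖∑ k, v k * f' (EuclideanSpace.single k 1)‖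
      ≤ ∑ k : Fin 3, ‖v k * f' (EuclideanSpace.single k 1)‖ := norm_sum_le _ _
    _ ≤ ∑ k : Fin 3, ‖v‖ * D := by
      refine Finset.sum_le_sum fun k _ => ?_
      rw [norm_mul]
      exact mul_le_mul (hvk k) (hk k) (norm_nonneg _) (norm_nonneg _)
    _ = 3 * D * ‖v‖ := by simp; ring

set_option maxHeartbeats 1000000 in
lemma exists_bad (s : ℝ) (hs : 0 < s) (Q : E3 → M3) (D : ℝ) (hD : 0 ≤ D)
    (hc : ContinuousOn Q (closedBall (0 : E3) 1))
    (hd : ∀ x ∈ ball (0 : E3) 1, DifferentiableAt ℝ Q x)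
    (hS0 : ∀ x ∈ closedBall (0 : E3) 1, Q x ∈ S0)
    (hbd : ∀ x ∈ sphere (0 : E3) 1,
          Q x = s • (Matrix.vecMulVec (fun i => x i) (fun i => x i) - (1 / 3 : ℝ) • (1 : M3)))
    (hL : ∀ x ∈ ball (0 : E3) 1, ∀ y ∈ ball (0 : E3) 1, ‖Q x - Q y‖ ≤ D * ‖x - y‖) :
    ∃ x ∈ ball (0 : E3) 1, 1 / 8 ≤ defect s (Q x) := by
  by_contra hcon
  push Not at hcon
  have hTS : ∀ x ∈ sphere (0 : E3) 1, Tm s (Q x) = Matrix.vecMulVec (fun i => x i) (fun i => x i) := by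
    intro x hx
    rw [hbd x hx, Tm, smul_smul, inv_mul_cancel₀ hs.ne', one_smul, sub_add_cancel]
  have hPhiS : ∀ x ∈ sphere (0 : E3) 1, ∀ v, Phi (Tm s (Q x)) v = (inner ℝ x v : ℝ) • x := by
    intro x hx v
    rw [hTS x hx]
    ext i
    rw [Phi_entry]
    simp [Matrix.vecMulVec_apply, PiLp.inner_apply, Fin.sum_univ_three]
    ring
  have hLc : ∀ x ∈ closedBall (0 : E3) 1, ∀ y ∈ closedBall (0 : E3) 1,
      ‖Q x - Q y‖ ≤ D * ‖x - y‖ := by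
    have h1 : LipschitzOnWith ⟨D, hD⟩ Q (ball (0 : E3) 1) :=
      LipschitzOnWith.of_dist_le_mul (by
        intro x hx y hy; rw [dist_eq_norm, dist_eq_norm]; exact hL x hx y hy)
    have hcl : closure (ball (0 : E3) 1) = closedBall 0 1 := closure_ball _ one_ne_zero
    have h2 := LipschitzOnWith.closure (by rw [hcl]; exact hc) h1
    rw [hcl] at h2
    intro x hx y hy
    have := h2.dist_le_mul x hx y hy
    rwa [dist_eq_norm, dist_eq_norm] at this
  have hgood : ∀ x ∈ closedBall (0 : E3) 1,
      ‖Phi (Tm s (Q x)) * Phi (Tm s (Q x)) - Phi (Tm s (Q x))‖ ≤ 1 / 8 := by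
    intro x hx
    by_cases hb : x ∈ ball (0 : E3) 1
    · have := (hcon x hb).le
      unfold defect at this
      rwa [map_sub, Phi_mul] at this
    · have hxs : x ∈ sphere (0 : E3) 1 := by
        simp only [mem_closedBall_zero_iff, mem_ball_zero_iff, mem_sphere_zero_iff_norm, not_lt] at *
        exact le_antisymm hx hb
      have hx1 : ‖x‖ = 1 := by simpa using hxs
      have : Phi (Tm s (Q x)) * Phi (Tm s (Q x)) - Phi (Tm s (Q x)) = 0 := by
        refine ContinuousLinearMap.ext fun v => ?_
        rw [_root_.sub_apply, mul_apply_eq_comp, hPhiS x hxs v, map_smul, hPhiS x hxs x,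
          real_inner_self_eq_norm_sq, hx1]
        simp
      rw [this, norm_zero]; norm_num
  -- starting vector
  have h00 : (0 : E3) ∈ closedBall (0 : E3) 1 := by simp
  have htr : (Tm s (Q 0)).trace = 1 := by
    have h := (hS0 0 h00).2
    rw [Tm, Matrix.trace_add, Matrix.trace_smul, Matrix.trace_smul, h, Matrix.trace_one]
    simp
  obtain ⟨i, hi⟩ : ∃ i, 1 / 3 ≤ Tm s (Q 0) i i := by
    by_contra hno
    push Not at hno
    rw [Matrix.trace_fin_three] at htr
    linarith [hno 0, hno 1, hno 2]
  set w : E3 := EuclideanSpace.single i 1 with hw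
  have hwn : ‖w‖ = 1 := by rw [hw]; simp
  set e : E3 := Phi (Tm s (Q 0)) w with he
  have hei : e i = Tm s (Q 0) i i := by
    rw [he, Phi_entry]; simp [hw]
  have hen : 1 / 3 ≤ ‖e‖ := by
    have h1 : ‖e i‖ ≤ ‖e‖ := PiLp.norm_apply_le e i
    have h2 : e i ≤ ‖e i‖ := le_abs_self _
    linarith
  have hTd : ∀ x ∈ ball (0 : E3) 1, DifferentiableAt ℝ (fun x => Phi (Tm s (Q x))) x := by
    intro x hx
    have h1 : DifferentiableAt ℝ (fun x => Tm s (Q x)) x :=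
      ((hd x hx).const_smul s⁻¹).add_const _
    exact Phi.differentiableAt.comp x h1
  obtain ⟨P, hP0, hP⟩ := ContinuousLinearMap.bound Phi
  refine topo (fun x => Phi (Tm s (Q x))) (P * (s⁻¹ * D)) ?_ hTd hgood hPhiS e ?_ ?_
  · intro x hx y hy
    rw [← map_sub]
    refine (hP _).trans ?_
    have e1 : Tm s (Q x) - Tm s (Q y) = s⁻¹ • (Q x - Q y) := by
      unfold Tm; rw [smul_sub]; abel
    have hsi : 0 < s⁻¹ := inv_pos.2 hs
    rw [e1, norm_smul, Real.norm_of_nonneg hsi.le, mul_assoc, mul_assoc]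
    have := hLc x hx y hy
    gcongr
  · intro h0
    rw [h0, norm_zero] at hen; norm_num at hen
  · have h1 := (Phi (Tm s (Q 0)) * Phi (Tm s (Q 0)) - Phi (Tm s (Q 0))).le_opNorm w
    rw [_root_.sub_apply, mul_apply_eq_comp, hwn, mul_one] at h1
    have h2 := hgood 0 h00
    have h3 : ‖Phi (Tm s (Q 0)) e - e‖ ≤ 1 / 8 := h1.trans h2
    linarith

/-- lower bound `∫ f(Q) ≥ ε³/C` for maps with the hedgehog boundary
values and gradient of size at most `C'/ε`. -/
theorem stmt19 (a b c : ℝ) (ha : 0 ≤ a) (hb : 0 < b) (hc : 0 < c)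
    (M C' : ℝ) (hM : 0 < M) (hC' : 0 < C') :
    ∃ C : ℝ, 0 < C ∧
      ∀ ε ∈ Ioo (0 : ℝ) 1, ∀ Q : E3 → M3,
        ContinuousOn Q (closedBall (0 : E3) 1) →
        ContDiffOn ℝ (⊤ : ℕ∞) Q (ball (0 : E3) 1) →
        (∀ x ∈ closedBall (0 : E3) 1, Q x ∈ S0) →
        (∀ x ∈ sphere (0 : E3) 1,
          Q x = sstar a b c • (Matrix.vecMulVec (fun i => x i) (fun i => x i) - (1 / 3 : ℝ) • (1 : M3))) →
        (∀ x ∈ ball (0 : E3) 1, frobNorm (Q x) ≤ M) →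
        (∀ x ∈ ball (0 : E3) 1, Real.sqrt (gradSq Q x) ≤ C' / ε) →
        ε ^ 3 / C ≤ ∫ x in ball (0 : E3) 1, fbulk a b c (Q x) := by
  obtain ⟨δ, hδ, hlow⟩ := fbulk_lower a b c ha hb hc M
  have hspos : 0 < sstar a b c := by
    obtain ⟨h1, -⟩ := sstar_spec a b c ha hb hc
    by_contra h
    push Not at h
    nlinarith
  have hUC := (frob_compact M).uniformContinuousOn_of_continuous (fbulk_cont a b c).continuousOn
  obtain ⟨τ, hτ, hτf⟩ := Metric.uniformContinuousOn_iff.1 hUC (δ / 2) (by positivity)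
  set κ : ℝ := min 1 (τ / (6 * C')) with hκ
  have hκpos : 0 < κ := by rw [hκ]; positivity
  have hκ1 : κ ≤ 1 := min_le_left _ _
  have hκτ : κ * (3 * C') < τ := by
    have h1 : κ ≤ τ / (6 * C') := min_le_right _ _
    have h2 : κ * (3 * C') ≤ τ / (6 * C') * (3 * C') := by gcongr
    have h3 : τ / (6 * C') * (3 * C') = τ / 2 := by field_simp; norm_num
    linarith
  set V : ℝ := volume.real (ball (0 : E3) 1) with hV
  have hVpos : 0 < V := by
    rw [hV, Measure.real]
    exact ENNReal.toReal_pos (measure_ball_pos volume _ one_pos).ne' measure_ball_lt_top.ne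
  refine ⟨16 / (δ * κ ^ 3 * V), by positivity, ?_⟩
  intro ε hε Q hcont hsm hS0 hbdry hbound hgrad
  obtain ⟨hε0, hε1⟩ := hε
  have hd : ∀ x ∈ ball (0 : E3) 1, DifferentiableAt ℝ Q x := fun x hx =>
    (hsm.contDiffAt (isOpen_ball.mem_nhds hx)).differentiableAt (by simp)
  have hLip := Q_lip Q (C' / ε) (by positivity) hd hgrad
  obtain ⟨x0, hx0, hbad⟩ := exists_bad (sstar a b c) hspos Q (3 * (C' / ε)) (by positivity)
    hcont hd hS0 hbdry hLip
  have hx0n : ‖x0‖ < 1 := by simpa using hx0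
  have hf0 := hlow (Q x0) (hS0 x0 (ball_subset_closedBall hx0)) (hbound x0 hx0) hbad
  set ρ : ℝ := ε * κ with hρ
  have hρ0 : 0 < ρ := by positivity
  have hρ1 : ρ ≤ 1 := by nlinarith
  set y0 : E3 := (1 - ρ / 2) • x0 with hy0
  have hsub : ball y0 (ρ / 2) ⊆ ball (0 : E3) 1 := by
    intro z hz
    rw [mem_ball_iff_norm] at hz
    rw [mem_ball_zero_iff]
    have h1 : ‖y0‖ ≤ 1 - ρ / 2 := by
      rw [hy0, norm_smul, Real.norm_of_nonneg (by linarith)]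
      exact mul_le_of_le_one_right (by linarith) hx0n.le
    have h2 := norm_add_le y0 (z - y0)
    rw [add_sub_cancel] at h2
    linarith
  have hlb : ∀ z ∈ ball y0 (ρ / 2), δ / 2 ≤ fbulk a b c (Q z) := by
    intro z hz
    have hzB := hsub hz
    rw [mem_ball_iff_norm] at hz
    have h1 : ‖y0 - x0‖ ≤ ρ / 2 := by
      have : y0 - x0 = -((ρ / 2) • x0) := by rw [hy0, sub_smul, one_smul]; abel
      rw [this, norm_neg, norm_smul, Real.norm_of_nonneg (by linarith)]
      exact mul_le_of_le_one_right (by linarith) hx0n.le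
    have h2 : ‖z - x0‖ ≤ ρ := by
      have := norm_sub_le_norm_sub_add_norm_sub z y0 x0
      linarith
    have h3 := hLip z hzB x0 hx0
    have h4 : ‖Q z - Q x0‖ < τ := by
      calc ‖Q z - Q x0‖ ≤ 3 * (C' / ε) * ‖z - x0‖ := h3
        _ ≤ 3 * (C' / ε) * ρ := by gcongr
        _ = κ * (3 * C') := by rw [hρ]; field_simp
        _ < τ := hκτ
    have h5 := hτf (Q z) (hbound z hzB) (Q x0) (hbound x0 hx0) (by rw [dist_eq_norm]; exact h4)
    rw [Real.dist_eq] at h5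
    have := (abs_lt.1 h5).1
    linarith
  have hfc : ContinuousOn (fun x => fbulk a b c (Q x)) (closedBall (0 : E3) 1) :=
    (fbulk_cont a b c).comp_continuousOn hcont
  have hint : IntegrableOn (fun x => fbulk a b c (Q x)) (ball (0 : E3) 1) :=
    (hfc.integrableOn_compact (isCompact_closedBall _ _)).mono_set ball_subset_closedBall
  have hmono : ∫ x in ball y0 (ρ / 2), fbulk a b c (Q x) ≤
      ∫ x in ball (0 : E3) 1, fbulk a b c (Q x) := by
    refine setIntegral_mono_set hint ?_ (Filter.Eventually.of_forall hsub)
    refine (ae_restrict_iff' measurableSet_ball).2 (Filter.Eventually.of_forall fun x hx => ?_)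
    exact (f_main a b c ha hb hc (Q x) (hS0 x (ball_subset_closedBall hx))).1
  have hconst : ∫ _x in ball y0 (ρ / 2), (δ / 2) ≤ ∫ x in ball y0 (ρ / 2), fbulk a b c (Q x) :=
    setIntegral_mono_on (integrableOn_const measure_ball_lt_top.ne) (hint.mono_set hsub)
      measurableSet_ball hlb
  have hvol : volume.real (ball y0 (ρ / 2)) = (ρ / 2) ^ 3 * V := by
    rw [hV, Measure.real, Measure.real, Measure.addHaar_ball _ _ (by positivity),
      ENNReal.toReal_mul, ENNReal.toReal_ofReal (by positivity)]
    simp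
  rw [setIntegral_const, hvol, smul_eq_mul] at hconst
  refine le_trans (le_of_eq ?_) (hconst.trans hmono)
  rw [hρ]
  field_simp
  norm_num

end
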